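/- Let p and q be coprime positive integers with q ≡ 0 (mod 4), let m be an integer, and let φ be an integer with p·φ ≡ 1 (mod q). Then G(-p, 2m+2, q) · conj(G(-p, 2m, q)) = 2q · exp(2πi φ (2m+1)/q). -/

import Mathlib

/-- The generalized quadratic Gauss sum
`G(a, b, c) = ∑_{l=0}^{c-1} exp(2πi(a l² + b l)/c)`. -/
noncomputable def gaussG (a b : ℤ) (c : ℕ) : ℂ :=
  ∑ l ∈ Finset.range c,
    Complex.exp (2 * (Real.pi : ℂ) * Complex.I *
      ((a : ℂ) * (l : ℂ) ^ 2 + (b : ℂ) * (l : ℂ)) / (c : ℂ))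

theorem gaussG_eq_sum_stdAddChar (a b : ℤ) (c : ℕ) [NeZero c] :
    gaussG a b c = ∑ x : ZMod c, ZMod.stdAddChar ((a : ZMod c) * x ^ 2 + (b : ZMod c) * x) := by
  unfold gaussG
  refine Finset.sum_bij' (fun l _ ↦ (l : ZMod c)) (fun x _ ↦ x.val) (by simp)
    (fun x _ ↦ Finset.mem_range.2 x.val_lt)
    (fun l hl ↦ ZMod.val_cast_of_lt (Finset.mem_range.1 hl)) (by simp) fun l _ ↦ ?_
  have h := ZMod.stdAddChar_coe (N := c) (a * (l : ℤ) ^ 2 + b * l)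
  push_cast at h
  exact h.symm

/-- Completing the square. -/
theorem sum_stdAddChar_quadratic {q : ℕ} [NeZero q] {p φ : ZMod q} (h : p * φ = 1)
    (m : ZMod q) :
    ∑ x : ZMod q, ZMod.stdAddChar (-p * x ^ 2 + 2 * m * x) =
      ZMod.stdAddChar (φ * m ^ 2) * ∑ x : ZMod q, ZMod.stdAddChar (-p * x ^ 2) := by
  rw [← Equiv.sum_comp (Equiv.addRight (φ * m)), Finset.mul_sum]
  refine Finset.sum_congr rfl fun x _ ↦ ?_
  rw [← AddChar.map_add_eq_mul, Equiv.coe_addRight]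
  congr 1
  linear_combination (-2 * x * m - φ * m ^ 2) * h

theorem ZMod.two_mul_eq_zero_iff {k : ℕ} (t : ZMod (2 * k)) :
    2 * t = 0 ↔ t = 0 ∨ t = k := by
  constructor
  · obtain ⟨n, rfl⟩ := ZMod.intCast_surjective t
    intro h
    have h' : ((2 * n : ℤ) : ZMod (2 * k)) = 0 := by exact_mod_cast h
    rw [ZMod.intCast_zmod_eq_zero_iff_dvd] at h'
    push_cast at h'
    obtain ⟨j, rfl⟩ := (mul_dvd_mul_iff_left (two_ne_zero' ℤ)).1 h'
    have hk : (2 * k : ZMod (2 * k)) = 0 := by exact_mod_cast ZMod.natCast_self (2 * k)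
    obtain ⟨i, rfl | rfl⟩ := Int.even_or_odd' j
    · left
      push_cast
      linear_combination (i : ZMod (2 * k)) * hk
    · right
      push_cast
      linear_combination (i : ZMod (2 * k)) * hk
  · rintro (rfl | rfl)
    · simp
    · exact_mod_cast ZMod.natCast_self (2 * k)

theorem sum_stdAddChar_sq_mul_conj {q : ℕ} [NeZero q] (hq : 4 ∣ q) {p : ZMod q}
    (hp : IsUnit p) :
    (∑ x : ZMod q, ZMod.stdAddChar (-p * x ^ 2)) *
      (starRingEnd ℂ) (∑ x : ZMod q, ZMod.stdAddChar (-p * x ^ 2)) = 2 * q := by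
  have hswap : (∑ x : ZMod q, ZMod.stdAddChar (-p * x ^ 2)) *
      (starRingEnd ℂ) (∑ x : ZMod q, ZMod.stdAddChar (-p * x ^ 2)) =
      ∑ t : ZMod q, ZMod.stdAddChar (-p * t ^ 2) *
        ∑ y : ZMod q, ZMod.stdAddChar (y * (-p * (2 * t))) := by
    rw [map_sum, Finset.sum_mul_sum, Finset.sum_comm]
    simp_rw [Finset.mul_sum]
    conv_rhs => rw [Finset.sum_comm]
    refine Finset.sum_congr rfl fun y _ ↦ ?_
    rw [← Equiv.sum_comp (Equiv.addRight y)]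
    refine Finset.sum_congr rfl fun t _ ↦ ?_
    rw [← AddChar.map_neg_eq_conj, ← AddChar.map_add_eq_mul, ← AddChar.map_add_eq_mul,
      Equiv.coe_addRight]
    congr 1
    ring
  rw [hswap]
  obtain ⟨k, rfl⟩ : ∃ k, q = 2 * (2 * k) := by
    obtain ⟨k, rfl⟩ := hq
    exact ⟨k, by ring⟩
  have hk : (2 * (2 * k) : ZMod (2 * (2 * k))) = 0 := by
    exact_mod_cast ZMod.natCast_self (2 * (2 * k))
  have hne : (0 : ZMod (2 * (2 * k))) ≠ ((2 * k : ℕ) : ZMod (2 * (2 * k))) := by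
    have := NeZero.ne (2 * (2 * k))
    intro h
    have := Nat.le_of_dvd (by lia) ((ZMod.natCast_eq_zero_iff _ _).1 h.symm)
    lia
  have hfilter : (Finset.univ.filter fun t : ZMod (2 * (2 * k)) ↦ -p * (2 * t) = 0) =
      {0, ((2 * k : ℕ) : ZMod (2 * (2 * k)))} := by
    ext t
    simp only [Finset.mem_filter, Finset.mem_univ, true_and, Finset.mem_insert,
      Finset.mem_singleton, hp.neg.mul_right_eq_zero]
    exact ZMod.two_mul_eq_zero_iff t
  simp_rw [AddChar.sum_mulShift _ (ZMod.isPrimitive_stdAddChar _), Nat.cast_ite, mul_ite,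
    Nat.cast_zero, mul_zero]
  rw [← Finset.sum_filter, hfilter, Finset.sum_pair hne]
  have hsq : -p * ((2 * k : ℕ) : ZMod (2 * (2 * k))) ^ 2 = 0 := by
    push_cast
    linear_combination -p * k * hk
  rw [hsq, zero_pow two_ne_zero, mul_zero, AddChar.map_zero_eq_one, ZMod.card]
  ring

theorem stmt_9 (p q : ℕ) (hp : 0 < p) (hq : 0 < q) (hpq : Nat.Coprime p q)
    (hq4 : q % 4 = 0) (m φ : ℤ) (hφ : (p : ℤ) * φ ≡ 1 [ZMOD (q : ℤ)]) :
    gaussG (-(p : ℤ)) (2 * m + 2) q * (starRingEnd ℂ) (gaussG (-(p : ℤ)) (2 * m) q) =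
      2 * (q : ℂ) *
        Complex.exp (2 * (Real.pi : ℂ) * Complex.I * (φ : ℂ) * (2 * (m : ℂ) + 1) / (q : ℂ)) := by
  have : NeZero q := ⟨hq.ne'⟩
  have hinv : (p : ZMod q) * φ = 1 := by
    exact_mod_cast (ZMod.intCast_eq_intCast_iff _ _ _).2 hφ
  have hG (n : ℤ) : gaussG (-(p : ℤ)) (2 * n) q = ZMod.stdAddChar ((φ : ZMod q) * (n : ZMod q) ^ 2) *
      ∑ x : ZMod q, ZMod.stdAddChar (-(p : ZMod q) * x ^ 2) := by
    rw [← sum_stdAddChar_quadratic hinv, gaussG_eq_sum_stdAddChar]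
    push_cast
    rfl
  have hexp : Complex.exp (2 * (Real.pi : ℂ) * Complex.I * (φ : ℂ) * (2 * (m : ℂ) + 1) / q) =
      ZMod.stdAddChar ((φ : ZMod q) * (2 * (m : ZMod q) + 1)) := by
    have h := ZMod.stdAddChar_coe (N := q) (φ * (2 * m + 1))
    push_cast at h
    rw [h, ← mul_assoc]
  have hphase : ZMod.stdAddChar ((φ : ZMod q) * ((m + 1 : ℤ) : ZMod q) ^ 2) *
      (starRingEnd ℂ) (ZMod.stdAddChar ((φ : ZMod q) * (m : ZMod q) ^ 2)) =
      ZMod.stdAddChar ((φ : ZMod q) * (2 * (m : ZMod q) + 1)) := by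
    rw [← AddChar.map_neg_eq_conj, ← AddChar.map_add_eq_mul]
    congr 1
    push_cast
    ring
  rw [show 2 * m + 2 = 2 * (m + 1) by ring, hG, hG, hexp, map_mul (starRingEnd ℂ), mul_mul_mul_comm, hphase,
    sum_stdAddChar_sq_mul_conj (Nat.dvd_of_mod_eq_zero hq4) (IsUnit.of_mul_eq_one _ hinv),
    mul_comm]
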